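/- arXiv:2302.14615 — 5 statements merged into one kernel-verified Lean document; each statement's English description precedes it below -/
import Mathlib

section
/- Let a set of N workers be partitioned into categories C_0, …, C_k of sizes m_0, …, m_k (Σ_ℓ m_ℓ = N), let n ≤ N and let g ≥ 1, 0 ≤ ℓ ≤ k. Then the number of subsets S of the worker set with |S| = n such that |S ∩ C_ℓ| = g and |S ∩ C_{ℓ'}| ≤ g − 1 for every ℓ' ≠ ℓ equals C(m_ℓ, g) · a_{g,ℓ}. Consequently, if a size-n subset of workers is chosen uniformly at random, the probability that the mode is in category ℓ with mode number g is C(m_ℓ, g) · a_{g,ℓ} / C(N, n). -/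
open Finset Polynomial

/-- `∑_{j=0}^{g−1} C(mc, j) x^j`. -/
noncomputable def catPoly (mc g : ℕ) : Polynomial ℕ :=
  ∑ j ∈ Finset.range g, Polynomial.C (mc.choose j) * Polynomial.X ^ j

/-- `a_{g,ℓ}`: the coefficient of `x^{n−g}` in `∏_{ℓ'≠ℓ} (∑_{j=0}^{g−1} C(m ℓ', j) x^j)`. -/
noncomputable def aCoeff (k : ℕ) (m : Fin (k + 1) → ℕ) (n g : ℕ) (ℓ : Fin (k + 1)) : ℕ :=
  (∏ ℓ' ∈ Finset.univ.erase ℓ, catPoly (m ℓ') g).coeff (n - g)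

/-- The generating polynomial, by cardinality, of the subsets of `s` with cardinality in `J`. -/
theorem sum_choose_mul_X_pow_eq {α : Type*} (s : Finset α) (J : Finset ℕ) :
    ∑ j ∈ J, Polynomial.C (s.card.choose j) * Polynomial.X ^ j
      = ∑ T ∈ s.powerset.filter (fun T => T.card ∈ J), (Polynomial.X : Polynomial ℕ) ^ T.card := by
  classical
  rw [← Finset.sum_fiberwise_of_maps_to (t := J) (g := Finset.card)
    (fun T hT => (Finset.mem_filter.mp hT).2)]
  refine Finset.sum_congr rfl fun j hj => ?_
  have hfib : (s.powerset.filter (fun T => T.card ∈ J)).filter (fun T => T.card = j)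
      = s.powersetCard j := by
    ext T
    simp only [Finset.mem_filter, Finset.mem_powerset, Finset.mem_powersetCard]
    constructor
    · rintro ⟨⟨h, -⟩, h'⟩
      exact ⟨h, h'⟩
    · rintro ⟨h, rfl⟩
      exact ⟨⟨h, hj⟩, rfl⟩
  rw [hfib, Finset.sum_congr rfl fun T hT => by rw [(Finset.mem_powersetCard.mp hT).2],
    Finset.sum_const, Finset.card_powersetCard, nsmul_eq_mul]
  simp

/-- The generating polynomial, by cardinality, of the sets whose intersection with each part `C i`
of a partition has cardinality in `J i` is a product over the parts. -/
theorem prod_sum_choose_mul_X_pow_eq {α ι : Type*} [DecidableEq α] [Fintype α]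
    [DecidableEq ι] [Fintype ι] (C : ι → Finset α)
    (hdisj : ∀ i j, i ≠ j → Disjoint (C i) (C j))
    (hcover : Finset.univ.biUnion C = Finset.univ) (J : ι → Finset ℕ) :
    ∏ i, ∑ j ∈ J i, Polynomial.C ((C i).card.choose j) * Polynomial.X ^ j
      = ∑ S : Finset α with ∀ i, (S ∩ C i).card ∈ J i,
          (Polynomial.X : Polynomial ℕ) ^ S.card := by
  have hunion (S : Finset α) : Finset.univ.biUnion (fun i => S ∩ C i) = S := by
    rw [← Finset.inter_biUnion, hcover, Finset.inter_univ]
  have hinter (f : ι → Finset α) (hf : ∀ i, f i ⊆ C i) (i : ι) :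
      Finset.univ.biUnion f ∩ C i = f i := by
    ext x
    simp only [Finset.mem_inter, Finset.mem_biUnion, Finset.mem_univ, true_and]
    constructor
    · rintro ⟨⟨j, hj⟩, hi⟩
      by_cases h : j = i
      · exact h ▸ hj
      · exact absurd hi (Finset.disjoint_left.mp (hdisj j i h) (hf j hj))
    · exact fun h => ⟨⟨i, h⟩, hf i h⟩
  simp_rw [sum_choose_mul_X_pow_eq]
  rw [Finset.prod_univ_sum]
  refine Finset.sum_nbij' (fun f => Finset.univ.biUnion f) (fun S i => S ∩ C i) ?_ ?_ ?_ ?_ ?_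
  · intro f hf
    simp only [Fintype.mem_piFinset, Finset.mem_filter, Finset.mem_powerset] at hf
    simp only [Finset.mem_filter, Finset.mem_univ, true_and]
    intro i
    rw [hinter f (fun i => (hf i).1) i]
    exact (hf i).2
  · intro S hS
    simp only [Finset.mem_filter, Finset.mem_univ, true_and] at hS
    simp only [Fintype.mem_piFinset, Finset.mem_filter, Finset.mem_powerset]
    exact fun i => ⟨Finset.inter_subset_right, hS i⟩
  · intro f hf
    simp only [Fintype.mem_piFinset, Finset.mem_filter, Finset.mem_powerset] at hf
    exact funext (hinter f fun i => (hf i).1)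
  · exact fun S _ => hunion S
  · intro f hf
    simp only [Fintype.mem_piFinset, Finset.mem_filter, Finset.mem_powerset] at hf
    rw [Finset.prod_pow_eq_pow_sum, Finset.card_biUnion]
    exact fun i _ j _ hij => (hdisj i j hij).mono (hf i).1 (hf j).1

/-- With `N` workers partitioned into categories `C 0, …, C k` of sizes
`m 0, …, m k`, `n ≤ N`, `g ≥ 1`: the number of size-`n` subsets `S` with
`|S ∩ C ℓ| = g` and `|S ∩ C ℓ'| ≤ g − 1` for all `ℓ' ≠ ℓ` equals
`C(m ℓ, g) · a_{g,ℓ}`; consequently, for a uniformly random size-`n` subset, the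
probability that the mode is in category `ℓ` with mode number `g` is
`C(m ℓ, g) · a_{g,ℓ} / C(N, n)`. -/
theorem stmt_1 {α : Type*} [DecidableEq α] [Fintype α]
    (N k n g : ℕ) (hcard : Fintype.card α = N)
    (C : Fin (k + 1) → Finset α)
    (hdisj : ∀ i j : Fin (k + 1), i ≠ j → Disjoint (C i) (C j))
    (hcover : Finset.univ.biUnion C = (Finset.univ : Finset α))
    (m : Fin (k + 1) → ℕ) (hm : ∀ ℓ, (C ℓ).card = m ℓ)
    (hn : n ≤ N) (hg : 1 ≤ g) (hgn : g ≤ n) (ℓ : Fin (k + 1)) :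
    (((Finset.powersetCard n (Finset.univ : Finset α)).filter
        (fun S => (S ∩ C ℓ).card = g ∧
          ∀ ℓ' : Fin (k + 1), ℓ' ≠ ℓ → (S ∩ C ℓ').card ≤ g - 1)).card
      = (m ℓ).choose g * aCoeff k m n g ℓ)
    ∧ ((((Finset.powersetCard n (Finset.univ : Finset α)).filter
        (fun S => (S ∩ C ℓ).card = g ∧
          ∀ ℓ' : Fin (k + 1), ℓ' ≠ ℓ → (S ∩ C ℓ').card ≤ g - 1)).card : ℚ)
        / (N.choose n : ℚ)
      = ((m ℓ).choose g * aCoeff k m n g ℓ : ℚ) / (N.choose n : ℚ)) := by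
  have hcount : ((Finset.powersetCard n (Finset.univ : Finset α)).filter
        (fun S => (S ∩ C ℓ).card = g ∧
          ∀ ℓ' : Fin (k + 1), ℓ' ≠ ℓ → (S ∩ C ℓ').card ≤ g - 1)).card
      = (m ℓ).choose g * aCoeff k m n g ℓ := by
    have hprod := congrArg (fun p => Polynomial.coeff p n) (prod_sum_choose_mul_X_pow_eq C
      hdisj hcover (fun i => if i = ℓ then {g} else Finset.range g))
    have herase : ∏ i ∈ Finset.univ.erase ℓ,
        ∑ j ∈ (if i = ℓ then {g} else Finset.range g),
          Polynomial.C ((C i).card.choose j) * Polynomial.X ^ j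
        = ∏ i ∈ Finset.univ.erase ℓ, catPoly (m i) g := by
      refine Finset.prod_congr rfl fun i hi => ?_
      rw [if_neg (Finset.ne_of_mem_erase hi), hm, catPoly]
    simp only [Polynomial.finsetSum_coeff, Polynomial.coeff_X_pow] at hprod
    rw [← Finset.mul_prod_erase _ _ (Finset.mem_univ ℓ), herase, if_pos rfl,
      Finset.sum_singleton, hm, mul_assoc, Polynomial.coeff_C_mul, Polynomial.coeff_X_pow_mul',
      if_pos hgn, ← Finset.card_filter, Finset.filter_filter] at hprod
    rw [aCoeff, hprod]
    congr 1
    ext S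
    simp only [Finset.mem_filter, Finset.mem_powersetCard, Finset.subset_univ, Finset.mem_univ,
      true_and]
    constructor
    · rintro ⟨hS, hSg, hSle⟩
      refine ⟨fun i => ?_, hS.symm⟩
      by_cases h : i = ℓ
      · simp [h, hSg]
      · have := hSle i h
        rw [if_neg h, Finset.mem_range]
        omega
    · rintro ⟨h, hS⟩
      refine ⟨hS.symm, by simpa using h ℓ, fun i hi => ?_⟩
      have := h i
      rw [if_neg hi, Finset.mem_range] at this
      omega
  exact ⟨hcount, by rw [hcount, Nat.cast_mul]⟩
end

section
/- Let a set of N workers be partitioned into categories C_0, …, C_k of sizes m_0, …, m_k (Σ_ℓ m_ℓ = N), let n ≤ N, and set g_0 = max(⌈n/(k+1)⌉, ⌈n·m_0/N⌉). Then the number of size-n subsets S of the worker set for which there exist ℓ ∈ {0,…,k} and g with g_0 ≤ g ≤ n such that |S ∩ C_ℓ| = g and |S ∩ C_{ℓ'}| ≤ g − 1 for all ℓ' ≠ ℓ equals Σ_{g=g_0}^{n} Σ_{ℓ=0}^{k} C(m_ℓ, g) · a_{g,ℓ}. Consequently, under a uniformly random size-n subset, the probability that there is a mode (with mode number at least g_0)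 is q = Σ_{g=g_0}^{n} Σ_{ℓ=0}^{k} C(m_ℓ, g) a_{g,ℓ} / C(N, n), and the probability that category ℓ is the mode is q̂_ℓ = Σ_{g=g_0}^{n} C(m_ℓ, g) a_{g,ℓ} / C(N, n). -/
open Finset Polynomial

/-- The minimal mode number `g₀ = max(⌈n/(k+1)⌉, ⌈n·m₀/N⌉)`. -/
noncomputable def gZero (k n N m0 : ℕ) : ℕ :=
  max ⌈(n : ℚ) / (k + 1)⌉₊ ⌈(n * m0 : ℚ) / (N : ℚ)⌉₊

/-- Summing a product of functions of the blocks of a partition over all subsets factors over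
the blocks. -/
theorem sum_prod_inter_card_eq_prod_sum {α ι R : Type*} [DecidableEq α] [Fintype α]
    [Fintype ι] [DecidableEq ι] [CommSemiring R] (C : ι → Finset α)
    (hdisj : ∀ i j : ι, i ≠ j → Disjoint (C i) (C j))
    (hcover : Finset.univ.biUnion C = (Finset.univ : Finset α)) (f : ι → ℕ → R) :
    ∑ S : Finset α, ∏ i, f i (S ∩ C i).card
      = ∏ i, ∑ j ∈ Finset.range ((C i).card + 1), (C i).card.choose j • f i j := by
  simp_rw [← Finset.sum_powerset_apply_card]
  rw [Finset.prod_univ_sum]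
  refine Finset.sum_nbij' (fun S i => S ∩ C i) (fun T => Finset.univ.biUnion T) ?_ ?_ ?_ ?_ ?_
  · intro S _
    simp [Fintype.mem_piFinset]
  · simp
  · intro S _
    rw [← Finset.inter_biUnion, hcover, Finset.inter_univ]
  · intro T hT
    simp only [Fintype.mem_piFinset, Finset.mem_powerset] at hT
    funext i
    ext x
    simp only [Finset.mem_inter, Finset.mem_biUnion, Finset.mem_univ, true_and]
    constructor
    · rintro ⟨⟨j, hj⟩, hx⟩
      by_cases hij : j = i
      · exact hij ▸ hj
      · exact absurd hx (Finset.disjoint_left.mp (hdisj j i hij) (hT j hj))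
    · exact fun hx => ⟨⟨i, hx⟩, hT i hx⟩
  · simp

theorem sum_inter_card_eq_card {α ι : Type*} [DecidableEq α] [Fintype α]
    [Fintype ι] [DecidableEq ι] (C : ι → Finset α)
    (hdisj : ∀ i j : ι, i ≠ j → Disjoint (C i) (C j))
    (hcover : Finset.univ.biUnion C = (Finset.univ : Finset α)) (S : Finset α) :
    ∑ i, (S ∩ C i).card = S.card := by
  rw [← Finset.card_biUnion, ← Finset.inter_biUnion, hcover, Finset.inter_univ]
  exact fun i _ j _ hij => (hdisj i j hij).mono Finset.inter_subset_right Finset.inter_subset_right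

theorem sum_range_choose_smul_ite_lt (c g : ℕ) :
    ∑ j ∈ Finset.range (c + 1), c.choose j • (if j < g then (X : ℕ[X]) ^ j else 0)
      = catPoly c g := by
  simp only [smul_ite, smul_zero, ← Finset.sum_filter, catPoly]
  refine Finset.sum_subset_zero_on_sdiff ?_ ?_ ?_
  · intro j
    simp
  · intro j hj
    have : c < j := by
      simp only [Finset.mem_sdiff, Finset.mem_range, Finset.mem_filter] at hj
      omega
    simp [Nat.choose_eq_zero_of_lt this]
  · intro j _
    simp [nsmul_eq_mul]

theorem sum_range_choose_smul_ite_eq (c g : ℕ) :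
    ∑ j ∈ Finset.range (c + 1), c.choose j • (if j = g then (X : ℕ[X]) ^ j else 0)
      = Polynomial.C (c.choose g) * X ^ g := by
  simp only [smul_ite, smul_zero, Finset.sum_ite_eq', Finset.mem_range]
  split_ifs with h
  · simp [nsmul_eq_mul]
  · simp [Nat.choose_eq_zero_of_lt (show c < g by omega)]

/-- The number of size-`n` subsets in which `ℓ` is the mode with mode number `g`. -/
theorem card_filter_mode_eq {α : Type*} [DecidableEq α] [Fintype α] {k : ℕ}
    (C : Fin (k + 1) → Finset α)
    (hdisj : ∀ i j : Fin (k + 1), i ≠ j → Disjoint (C i) (C j))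
    (hcover : Finset.univ.biUnion C = (Finset.univ : Finset α))
    (m : Fin (k + 1) → ℕ) (hm : ∀ ℓ, (C ℓ).card = m ℓ) {n g : ℕ} (hg : g ≤ n)
    (ℓ : Fin (k + 1)) :
    ((Finset.powersetCard n (Finset.univ : Finset α)).filter
      (fun S => (S ∩ C ℓ).card = g ∧ ∀ ℓ' : Fin (k + 1), ℓ' ≠ ℓ → (S ∩ C ℓ').card < g)).card
      = (m ℓ).choose g * aCoeff k m n g ℓ := by
  have key := sum_prod_inter_card_eq_prod_sum C hdisj hcover
    (fun i c => if (if i = ℓ then c = g else c < g) then (X : ℕ[X]) ^ c else 0)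
  rw [← Finset.mul_prod_erase Finset.univ _ (Finset.mem_univ ℓ)] at key
  simp only [if_true, sum_range_choose_smul_ite_eq] at key
  have hrest : ∏ i ∈ Finset.univ.erase ℓ, ∑ j ∈ Finset.range ((C i).card + 1),
      (C i).card.choose j • (if (if i = ℓ then j = g else j < g) then (X : ℕ[X]) ^ j else 0)
      = ∏ i ∈ Finset.univ.erase ℓ, catPoly (m i) g := by
    refine Finset.prod_congr rfl fun i hi => ?_
    simp only [if_neg (Finset.ne_of_mem_erase hi), sum_range_choose_smul_ite_lt, hm]
  rw [hrest, hm, mul_assoc] at key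
  have hcoeff := congrArg (fun p => p.coeff n) key
  simp only [Polynomial.coeff_C_mul, Polynomial.coeff_X_pow_mul', if_pos hg] at hcoeff
  rw [aCoeff, ← hcoeff, Polynomial.finsetSum_coeff, Finset.card_filter,
    Finset.powersetCard_eq_filter, Finset.sum_filter, Finset.powerset_univ]
  refine Finset.sum_congr rfl fun S _ => ?_
  rw [Finset.prod_ite_zero, Finset.prod_pow_eq_pow_sum,
    sum_inter_card_eq_card C hdisj hcover]
  have hiff : (∀ i ∈ Finset.univ, if i = ℓ then (S ∩ C i).card = g else (S ∩ C i).card < g) ↔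
      ((S ∩ C ℓ).card = g ∧ ∀ ℓ' : Fin (k + 1), ℓ' ≠ ℓ → (S ∩ C ℓ').card < g) := by
    constructor
    · intro h
      exact ⟨by simpa using h ℓ (Finset.mem_univ ℓ),
        fun i hi => by simpa [hi] using h i (Finset.mem_univ i)⟩
    · rintro ⟨h, h'⟩ i -
      split_ifs with hi
      · exact hi ▸ h
      · exact h' i hi
  simp only [hiff, ← ite_and, apply_ite (fun p : ℕ[X] => p.coeff n), Polynomial.coeff_X_pow,
    Polynomial.coeff_zero, eq_comm (a := n)]
  simp only [and_comm]

theorem gZero_pos {k n N m0 : ℕ} (hn : 1 ≤ n) : 0 < gZero k n N m0 := by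
  refine lt_max_of_lt_left (Nat.ceil_pos.mpr ?_)
  have : (0 : ℚ) < n := by exact_mod_cast hn
  positivity

/-- The number of size-`n` subsets in which `ℓ` is the mode with mode number at least `g₀`. -/
theorem card_filter_exists_mode_eq {α : Type*} [DecidableEq α] [Fintype α] {k : ℕ}
    (C : Fin (k + 1) → Finset α)
    (hdisj : ∀ i j : Fin (k + 1), i ≠ j → Disjoint (C i) (C j))
    (hcover : Finset.univ.biUnion C = (Finset.univ : Finset α))
    (m : Fin (k + 1) → ℕ) (hm : ∀ ℓ, (C ℓ).card = m ℓ) {n g₀ : ℕ} (hg₀ : 0 < g₀)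
    (ℓ : Fin (k + 1)) :
    ((Finset.powersetCard n (Finset.univ : Finset α)).filter
      (fun S => ∃ g ∈ Finset.Icc g₀ n, (S ∩ C ℓ).card = g ∧
        ∀ ℓ' : Fin (k + 1), ℓ' ≠ ℓ → (S ∩ C ℓ').card ≤ g - 1)).card
      = ∑ g ∈ Finset.Icc g₀ n, (m ℓ).choose g * aCoeff k m n g ℓ := by
  rw [← Finset.sum_congr rfl fun g hg =>
    card_filter_mode_eq C hdisj hcover m hm (Finset.mem_Icc.mp hg).2 ℓ, ← Finset.card_biUnion]
  · congr 1
    ext S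
    simp only [Finset.mem_filter, Finset.mem_biUnion]
    constructor
    · rintro ⟨hS, g, hg, h, h'⟩
      refine ⟨g, hg, hS, h, fun i hi => ?_⟩
      have := h' i hi
      have := (Finset.mem_Icc.mp hg).1
      omega
    · rintro ⟨g, hg, hS, h, h'⟩
      exact ⟨hS, g, hg, h, fun i hi => Nat.le_sub_one_of_lt (h' i hi)⟩
  · intro g _ g' _ hne
    refine Finset.disjoint_filter.mpr fun S _ h h' => hne (h.1.symm.trans h'.1)

/-- The number of size-`n` subsets having a mode with mode number at least `g₀`. -/
theorem card_filter_exists_exists_mode_eq {α : Type*} [DecidableEq α] [Fintype α] {k : ℕ}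
    (C : Fin (k + 1) → Finset α)
    (hdisj : ∀ i j : Fin (k + 1), i ≠ j → Disjoint (C i) (C j))
    (hcover : Finset.univ.biUnion C = (Finset.univ : Finset α))
    (m : Fin (k + 1) → ℕ) (hm : ∀ ℓ, (C ℓ).card = m ℓ) {n g₀ : ℕ} (hg₀ : 0 < g₀) :
    ((Finset.powersetCard n (Finset.univ : Finset α)).filter
      (fun S => ∃ ℓ : Fin (k + 1), ∃ g ∈ Finset.Icc g₀ n, (S ∩ C ℓ).card = g ∧
        ∀ ℓ' : Fin (k + 1), ℓ' ≠ ℓ → (S ∩ C ℓ').card ≤ g - 1)).card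
      = ∑ g ∈ Finset.Icc g₀ n, ∑ ℓ : Fin (k + 1), (m ℓ).choose g * aCoeff k m n g ℓ := by
  rw [Finset.sum_comm, ← Finset.sum_congr rfl fun ℓ _ =>
    card_filter_exists_mode_eq C hdisj hcover m hm hg₀ ℓ, ← Finset.card_biUnion]
  · congr 1
    ext S
    simp only [Finset.mem_filter, Finset.mem_biUnion, Finset.mem_univ, true_and]
    tauto
  · intro i _ j _ hne
    refine Finset.disjoint_filter.mpr ?_
    rintro S - ⟨g, hg, h, h'⟩ ⟨g', hg', e, e'⟩
    have := h' j hne.symm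
    have := e' i hne
    have := (Finset.mem_Icc.mp hg).1
    have := (Finset.mem_Icc.mp hg').1
    omega

/-- With `N` workers partitioned into categories of sizes `m ℓ`
and `n ≤ N` workers sampled, the number of size-`n` subsets having a mode (some
category with exact count `g`, `g₀ ≤ g ≤ n`, all other counts `≤ g − 1`) equals
`∑_{g=g₀}^{n} ∑_ℓ C(m ℓ, g)·a_{g,ℓ}`; hence under uniform sampling the probability
`q` that there is a mode is that sum divided by `C(N, n)`, and for each `ℓ` the
probability `q̂_ℓ` that category `ℓ` is the mode is
`∑_{g=g₀}^{n} C(m ℓ, g)·a_{g,ℓ}/C(N, n)`. -/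
theorem stmt_2 {α : Type*} [DecidableEq α] [Fintype α]
    (N k n : ℕ) (hcard : Fintype.card α = N)
    (C : Fin (k + 1) → Finset α)
    (hdisj : ∀ i j : Fin (k + 1), i ≠ j → Disjoint (C i) (C j))
    (hcover : Finset.univ.biUnion C = (Finset.univ : Finset α))
    (m : Fin (k + 1) → ℕ) (hm : ∀ ℓ, (C ℓ).card = m ℓ)
    (hn1 : 1 ≤ n) (hn : n ≤ N) :
    (((Finset.powersetCard n (Finset.univ : Finset α)).filter
        (fun S => ∃ ℓ : Fin (k + 1), ∃ g ∈ Finset.Icc (gZero k n N (m 0)) n,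
          (S ∩ C ℓ).card = g ∧
            ∀ ℓ' : Fin (k + 1), ℓ' ≠ ℓ → (S ∩ C ℓ').card ≤ g - 1)).card
      = ∑ g ∈ Finset.Icc (gZero k n N (m 0)) n, ∑ ℓ : Fin (k + 1),
          (m ℓ).choose g * aCoeff k m n g ℓ)
    ∧ ((((Finset.powersetCard n (Finset.univ : Finset α)).filter
        (fun S => ∃ ℓ : Fin (k + 1), ∃ g ∈ Finset.Icc (gZero k n N (m 0)) n,
          (S ∩ C ℓ).card = g ∧
            ∀ ℓ' : Fin (k + 1), ℓ' ≠ ℓ → (S ∩ C ℓ').card ≤ g - 1)).card : ℚ)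
        / (N.choose n : ℚ)
      = (∑ g ∈ Finset.Icc (gZero k n N (m 0)) n, ∑ ℓ : Fin (k + 1),
          ((m ℓ).choose g * aCoeff k m n g ℓ : ℚ)) / (N.choose n : ℚ))
    ∧ (∀ ℓ : Fin (k + 1),
        ((Finset.powersetCard n (Finset.univ : Finset α)).filter
          (fun S => ∃ g ∈ Finset.Icc (gZero k n N (m 0)) n,
            (S ∩ C ℓ).card = g ∧
              ∀ ℓ' : Fin (k + 1), ℓ' ≠ ℓ → (S ∩ C ℓ').card ≤ g - 1)).card
        = ∑ g ∈ Finset.Icc (gZero k n N (m 0)) n, (m ℓ).choose g * aCoeff k m n g ℓ)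
    ∧ (∀ ℓ : Fin (k + 1),
        (((Finset.powersetCard n (Finset.univ : Finset α)).filter
          (fun S => ∃ g ∈ Finset.Icc (gZero k n N (m 0)) n,
            (S ∩ C ℓ).card = g ∧
              ∀ ℓ' : Fin (k + 1), ℓ' ≠ ℓ → (S ∩ C ℓ').card ≤ g - 1)).card : ℚ)
          / (N.choose n : ℚ)
        = (∑ g ∈ Finset.Icc (gZero k n N (m 0)) n,
            ((m ℓ).choose g * aCoeff k m n g ℓ : ℚ)) / (N.choose n : ℚ)) := by
  have hpos : 0 < gZero k n N (m 0) := gZero_pos hn1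
  have htotal := card_filter_exists_exists_mode_eq C hdisj hcover m hm (n := n) hpos
  have hmode := card_filter_exists_mode_eq C hdisj hcover m hm (n := n) hpos
  refine ⟨htotal, ?_, hmode, fun ℓ => ?_⟩
  · rw [htotal]
    push_cast
    rfl
  · rw [hmode ℓ]
    push_cast
    rfl
end

section
/- Let τ be a finite index set of rows with a distinguished element t ∈ τ. For each s ∈ τ, let a set of N_s workers be partitioned into categories C_{s,0}, …, C_{s,k} of sizes m_{s,0}, …, m_{s,k}, and let n_s ≤ N_s. Fix g ≥ 1 and ℓ ∈ {0,…,k}. Then the number of tuples (S_s)_{s∈τ}, where each S_s is a size-n_s subset of row s's worker set, such that |S_t ∩ C_{t,ℓ}| = g, |S_t ∩ C_{t,ℓ'}| ≤ g − 1 for every ℓ' ≠ ℓ, and |S_s ∩ C_{s,ℓ''}| ≤ g − 1 for every s ∈ τ \ {t} and every category ℓ'', equals C(m_{t,ℓ}, g) · a^t_{g,ℓ} · ∏_{s∈τ\{t}} b^s_g. Consequently, if for each s ∈ τ a size-n_s subset is drawn uniformly and independently, then P(t, ℓ, g) = [C(m_{t,ℓ}, g) a^t_{g,ℓ} / C(N_t,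 n_t)] · ∏_{s∈τ\{t}} b^s_g / C(N_s, n_s). -/
open Finset Polynomial

/-- `b_g`: the coefficient of `x^n` in `∏_{ℓ=0}^{k} (∑_{j=0}^{g−1} C(m ℓ, j) x^j)`. -/
noncomputable def bCoeff (k : ℕ) (m : Fin (k + 1) → ℕ) (n g : ℕ) : ℕ :=
  (∏ ℓ : Fin (k + 1), catPoly (m ℓ) g).coeff n

/-- The generating function, by size, of the subsets `S` whose intersection with each block `C i`
of a partition has size in a prescribed set `A i`. -/
theorem sum_X_pow_card_eq_prod_of_partition {α κ : Type*} [Fintype α] [DecidableEq α]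
    [Fintype κ] [DecidableEq κ] (C : κ → Finset α)
    (hdisj : ∀ i j, i ≠ j → Disjoint (C i) (C j))
    (hcover : Finset.univ.biUnion C = (Finset.univ : Finset α)) (A : κ → Finset ℕ) :
    ∑ S ∈ (Finset.univ : Finset (Finset α)).filter (fun S => ∀ i, (S ∩ C i).card ∈ A i),
        (X : ℕ[X]) ^ S.card
      = ∏ i, ∑ j ∈ A i, Polynomial.C ((C i).card.choose j) * X ^ j := by
  have hblock : ∀ i, ∑ j ∈ A i, Polynomial.C ((C i).card.choose j) * (X : ℕ[X]) ^ j
      = ∑ T ∈ (C i).powerset.filter (fun T => T.card ∈ A i), X ^ T.card := by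
    intro i
    rw [← Finset.sum_fiberwise_of_maps_to (t := A i) (g := Finset.card)
      (fun T hT => (Finset.mem_filter.1 hT).2)]
    refine Finset.sum_congr rfl fun j hj => ?_
    have hfib : ((C i).powerset.filter (fun T => T.card ∈ A i)).filter (fun T => T.card = j)
        = Finset.powersetCard j (C i) := by
      ext T
      simp only [Finset.mem_filter, Finset.mem_powerset, Finset.mem_powersetCard]
      constructor
      · rintro ⟨⟨h, -⟩, h'⟩
        exact ⟨h, h'⟩
      · rintro ⟨h, rfl⟩
        exact ⟨⟨h, hj⟩, rfl⟩
    rw [hfib, Finset.sum_congr rfl (g := fun _ => (X : ℕ[X]) ^ j)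
      (fun T hT => by rw [(Finset.mem_powersetCard.1 hT).2])]
    simp
  have hinter : ∀ f : κ → Finset α, (∀ i, f i ⊆ C i) →
      ∀ i, Finset.univ.biUnion f ∩ C i = f i := by
    intro f hf i
    ext x
    simp only [Finset.mem_inter, Finset.mem_biUnion, Finset.mem_univ, true_and]
    constructor
    · rintro ⟨⟨j, hj⟩, hx⟩
      by_cases hij : i = j
      · exact hij ▸ hj
      · exact absurd (hf j hj) (Finset.disjoint_left.1 (hdisj i j hij) hx)
    · exact fun hx => ⟨⟨i, hx⟩, hf i hx⟩
  have hunion : ∀ S : Finset α, Finset.univ.biUnion (fun i => S ∩ C i) = S := by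
    intro S
    rw [← Finset.inter_biUnion, hcover, Finset.inter_univ]
  simp_rw [hblock]
  rw [Finset.prod_univ_sum]
  refine Finset.sum_bij' (fun S _ i => S ∩ C i) (fun f _ => Finset.univ.biUnion f)
    ?_ ?_ ?_ ?_ ?_
  · intro S hS
    simpa [Fintype.mem_piFinset, Finset.inter_subset_right] using hS
  · intro f hf
    simp only [Fintype.mem_piFinset, Finset.mem_filter, Finset.mem_powerset] at hf
    simp only [Finset.mem_filter, Finset.mem_univ, true_and]
    intro i
    rw [hinter f (fun i => (hf i).1)]
    exact (hf i).2
  · exact fun S _ => hunion S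
  · intro f hf
    simp only [Fintype.mem_piFinset, Finset.mem_filter, Finset.mem_powerset] at hf
    exact funext (hinter f fun i => (hf i).1)
  · intro S _
    rw [Finset.prod_pow_eq_pow_sum, ← Finset.card_biUnion, hunion]
    intro i _ j _ hij
    exact (hdisj i j hij).mono Finset.inter_subset_right Finset.inter_subset_right

theorem card_filter_powersetCard_eq_coeff {α κ : Type*} [Fintype α] [DecidableEq α]
    [Fintype κ] [DecidableEq κ] (C : κ → Finset α)
    (hdisj : ∀ i j, i ≠ j → Disjoint (C i) (C j))
    (hcover : Finset.univ.biUnion C = (Finset.univ : Finset α)) (A : κ → Finset ℕ) (n : ℕ) :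
    ((Finset.powersetCard n (Finset.univ : Finset α)).filter
        (fun S => ∀ i, (S ∩ C i).card ∈ A i)).card
      = (∏ i, ∑ j ∈ A i, Polynomial.C ((C i).card.choose j) * (X : ℕ[X]) ^ j).coeff n := by
  rw [← sum_X_pow_card_eq_prod_of_partition C hdisj hcover A, Polynomial.finsetSum_coeff]
  simp only [Polynomial.coeff_X_pow]
  rw [Finset.sum_boole, Finset.filter_filter, Nat.cast_id]
  congr 1
  ext S
  simp only [Finset.mem_filter, Finset.mem_powersetCard, Finset.subset_univ, Finset.mem_univ,
    true_and]
  rw [and_comm, eq_comm]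

theorem card_filter_forall_le_eq_bCoeff {α : Type*} [Fintype α] [DecidableEq α] (k : ℕ)
    (C : Fin (k + 1) → Finset α) (hdisj : ∀ i j, i ≠ j → Disjoint (C i) (C j))
    (hcover : Finset.univ.biUnion C = (Finset.univ : Finset α)) (n g : ℕ) (hg : 1 ≤ g) :
    ((Finset.powersetCard n (Finset.univ : Finset α)).filter
        (fun S => ∀ i, (S ∩ C i).card ≤ g - 1)).card
      = bCoeff k (fun i => (C i).card) n g := by
  unfold bCoeff catPoly
  rw [← card_filter_powersetCard_eq_coeff C hdisj hcover (fun _ => Finset.range g)]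
  simp only [Finset.mem_range, Nat.le_sub_one_iff_lt hg]

theorem card_filter_eq_and_forall_le_eq_choose_mul_aCoeff {α : Type*} [Fintype α]
    [DecidableEq α] (k : ℕ)
    (C : Fin (k + 1) → Finset α) (hdisj : ∀ i j, i ≠ j → Disjoint (C i) (C j))
    (hcover : Finset.univ.biUnion C = (Finset.univ : Finset α)) (n g : ℕ) (hg : 1 ≤ g)
    (hgn : g ≤ n) (ℓ : Fin (k + 1)) :
    ((Finset.powersetCard n (Finset.univ : Finset α)).filter
        (fun S => (S ∩ C ℓ).card = g ∧ ∀ i, i ≠ ℓ → (S ∩ C i).card ≤ g - 1)).card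
      = (C ℓ).card.choose g * aCoeff k (fun i => (C i).card) n g ℓ := by
  have hpred : ∀ S : Finset α,
      ((S ∩ C ℓ).card = g ∧ ∀ i, i ≠ ℓ → (S ∩ C i).card ≤ g - 1) ↔
        ∀ i, (S ∩ C i).card ∈ if i = ℓ then {g} else Finset.range g := by
    intro S
    constructor
    · rintro ⟨h, h'⟩ i
      split_ifs with hi
      · simpa [hi] using h
      · exact Finset.mem_range.2 ((Nat.le_sub_one_iff_lt hg).1 (h' i hi))
    · refine fun h => ⟨by simpa using h ℓ, fun i hi => ?_⟩
      have := h i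
      rw [if_neg hi, Finset.mem_range] at this
      exact (Nat.le_sub_one_iff_lt hg).2 this
  have hcount := card_filter_powersetCard_eq_coeff C hdisj hcover
    (fun i => if i = ℓ then {g} else Finset.range g) n
  simp only [← hpred] at hcount
  rw [hcount, ← Finset.mul_prod_erase _ _
      (Finset.mem_univ ℓ), if_pos rfl, Finset.sum_singleton, mul_assoc, Polynomial.coeff_C_mul,
    Polynomial.coeff_X_pow_mul', if_pos hgn, aCoeff]
  congr 2
  refine Finset.prod_congr rfl fun i hi => ?_
  rw [if_neg (Finset.ne_of_mem_erase hi), catPoly]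

/-- For rows `s ∈ τ` with a distinguished `t ∈ τ`, each row having
`N s` workers partitioned into categories `C s 0, …, C s k` of sizes `m s ℓ`,
and `n s ≤ N s` workers sampled per row: the number of tuples `(S_s)_{s∈τ}` of
size-`n s` subsets such that `|S_t ∩ C t ℓ| = g`, `|S_t ∩ C t ℓ'| ≤ g − 1` for
`ℓ' ≠ ℓ`, and `|S_s ∩ C s ℓ''| ≤ g − 1` for all `s ≠ t` and all `ℓ''` equals
`C(m t ℓ, g)·a^t_{g,ℓ}·∏_{s∈τ\{t}} b^s_g`; consequently, sampling uniformly and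
independently, `P(t, ℓ, g) = [C(m t ℓ, g)·a^t_{g,ℓ}/C(N t, n t)]·∏_{s∈τ\{t}} b^s_g/C(N s, n s)`. -/
theorem stmt_3 {ι : Type*} [DecidableEq ι] (τ : Finset ι) (t : ι) (ht : t ∈ τ)
    (k : ℕ) (N n : ι → ℕ)
    (C : (s : ι) → Fin (k + 1) → Finset (Fin (N s)))
    (hdisj : ∀ s, ∀ i j : Fin (k + 1), i ≠ j → Disjoint (C s i) (C s j))
    (hcover : ∀ s, Finset.univ.biUnion (C s) = (Finset.univ : Finset (Fin (N s))))
    (m : ι → Fin (k + 1) → ℕ) (hm : ∀ s ℓ, (C s ℓ).card = m s ℓ)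
    (hn : ∀ s, n s ≤ N s)
    (g : ℕ) (hg : 1 ≤ g) (hgt : g ≤ n t) (ℓ : Fin (k + 1)) :
    ((τ.pi (fun s => (Finset.powersetCard (n s) (Finset.univ : Finset (Fin (N s)))).filter
        (fun S => if s = t
          then ((S ∩ C s ℓ).card = g ∧
            ∀ ℓ' : Fin (k + 1), ℓ' ≠ ℓ → (S ∩ C s ℓ').card ≤ g - 1)
          else (∀ ℓ'' : Fin (k + 1), (S ∩ C s ℓ'').card ≤ g - 1)))).card
      = (m t ℓ).choose g * aCoeff k (m t) (n t) g ℓ *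
          ∏ s ∈ τ.erase t, bCoeff k (m s) (n s) g)
    ∧ (((τ.pi (fun s => (Finset.powersetCard (n s) (Finset.univ : Finset (Fin (N s)))).filter
        (fun S => if s = t
          then ((S ∩ C s ℓ).card = g ∧
            ∀ ℓ' : Fin (k + 1), ℓ' ≠ ℓ → (S ∩ C s ℓ').card ≤ g - 1)
          else (∀ ℓ'' : Fin (k + 1), (S ∩ C s ℓ'').card ≤ g - 1)))).card : ℚ)
        / ∏ s ∈ τ, ((N s).choose (n s) : ℚ)
      = (((m t ℓ).choose g * aCoeff k (m t) (n t) g ℓ : ℚ) / ((N t).choose (n t) : ℚ)) *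
          ∏ s ∈ τ.erase t, (bCoeff k (m s) (n s) g : ℚ) / ((N s).choose (n s) : ℚ)) := by
  rw [and_iff_left_of_imp]
  · rw [Finset.card_pi, ← Finset.mul_prod_erase _ _ ht]
    obtain rfl : (fun s ℓ => (C s ℓ).card) = m := funext fun s => funext fun ℓ => hm s ℓ
    congr 1
    · simp only [if_true]
      exact card_filter_eq_and_forall_le_eq_choose_mul_aCoeff k (C t) (hdisj t) (hcover t)
        (n t) g hg hgt ℓ
    · refine Finset.prod_congr rfl fun s hs => ?_
      simp only [if_neg (Finset.ne_of_mem_erase hs)]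
      exact card_filter_forall_le_eq_bCoeff k (C s) (hdisj s) (hcover s) (n s) g hg
  · intro h
    rw [h, ← Finset.mul_prod_erase τ (fun s => ((N s).choose (n s) : ℚ)) ht,
      Finset.prod_div_distrib]
    push_cast
    rw [div_mul_div_comm]
end

section
/- Let τ be a finite index set of rows with a distinguished element t ∈ τ, each row s ∈ τ having N_s workers partitioned into categories of sizes m_{s,0}, …, m_{s,k} with sample size n_s ≤ N_s. For each s ∈ τ draw a size-n_s subset uniformly and independently. Then the probability P(t, g) that row t's sample has a mode (in some category) with mode number g while all category counts of every other row's sample are strictly below g satisfies P(t, g) = Σ_{ℓ=0}^{k} P(t, ℓ, g) = q^t_g · ∏_{s∈τ\{t}} b^s_g / C(N_s, n_s), where q^t_g = Σ_{ℓ=0}^{k} C(m_{t,ℓ}, g) a^t_{g,ℓ} / C(N_t, n_t). -/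
open Finset Polynomial

section

variable {α κ : Type*}

/-- Generating function, by size, of the subsets of `A` whose size lies in `T`. -/
theorem sum_powerset_filter_X_pow_card (A : Finset α) (T : Finset ℕ) :
    ∑ S ∈ A.powerset with S.card ∈ T, (X : ℕ[X]) ^ S.card
      = ∑ j ∈ T, Polynomial.C (A.card.choose j) * X ^ j := by
  rw [← Finset.sum_fiberwise_of_maps_to (g := Finset.card) (t := T)
    (fun S hS => (Finset.mem_filter.1 hS).2)]
  refine Finset.sum_congr rfl fun j hj => ?_
  have hset : ((A.powerset.filter fun S => S.card ∈ T).filter fun S => S.card = j)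
      = Finset.powersetCard j A := by
    ext S
    simp only [Finset.mem_filter, Finset.mem_powerset, Finset.mem_powersetCard]
    constructor
    · rintro ⟨⟨h, -⟩, h'⟩
      exact ⟨h, h'⟩
    · rintro ⟨h, h'⟩
      exact ⟨⟨h, h' ▸ hj⟩, h'⟩
  rw [hset, Finset.sum_congr rfl fun S hS => by rw [(Finset.mem_powersetCard.1 hS).2],
    Finset.sum_const, Finset.card_powersetCard, nsmul_eq_mul]
  simp

variable [DecidableEq α] [DecidableEq κ]

/-- Generating function, by size, of the subsets of a disjoint union whose intersection sizes with
the parts are constrained. -/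
theorem prod_sum_choose_X_pow (I : Finset κ) (C : κ → Finset α) (T : κ → Finset ℕ)
    (hdisj : ∀ i j, i ≠ j → Disjoint (C i) (C j)) :
    ∏ i ∈ I, ∑ j ∈ T i, Polynomial.C ((C i).card.choose j) * (X : ℕ[X]) ^ j
      = ∑ S ∈ (I.biUnion C).powerset with ∀ i ∈ I, (S ∩ C i).card ∈ T i, X ^ S.card := by
  induction I using Finset.induction_on with
  | empty => simp
  | insert a I ha ih =>
    have hd : Disjoint (C a) (I.biUnion C) := by
      rw [Finset.disjoint_biUnion_right]
      intro i hi
      exact hdisj a i (by rintro rfl; exact ha hi)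
    rw [Finset.prod_insert ha, ih, ← sum_powerset_filter_X_pow_card, Finset.sum_mul_sum,
      ← Finset.sum_product']
    refine Finset.sum_bij' (fun p _ => p.1 ∪ p.2) (fun S _ => (S ∩ C a, S ∩ I.biUnion C))
      ?_ ?_ ?_ ?_ ?_
    · rintro ⟨A, B⟩ h
      simp only [Finset.mem_product, Finset.mem_filter, Finset.mem_powerset] at h
      obtain ⟨⟨hA, hAT⟩, hB, hBT⟩ := h
      simp only [Finset.mem_filter, Finset.mem_powerset, Finset.biUnion_insert,
        Finset.forall_mem_insert]
      refine ⟨Finset.union_subset_union hA hB, ?_, fun i hi => ?_⟩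
      · rwa [Finset.union_inter_distrib_right, Finset.inter_eq_left.2 hA,
          Finset.disjoint_iff_inter_eq_empty.1 (hd.symm.mono_left hB), Finset.union_empty]
      · have hai : Disjoint (C a) (C i) := hdisj a i (by rintro rfl; exact ha hi)
        rw [Finset.union_inter_distrib_right,
          Finset.disjoint_iff_inter_eq_empty.1 (hai.mono_left hA), Finset.empty_union]
        exact hBT i hi
    · intro S h
      simp only [Finset.mem_filter, Finset.mem_powerset, Finset.biUnion_insert,
        Finset.forall_mem_insert] at h
      obtain ⟨-, hST, hS⟩ := h
      simp only [Finset.mem_product, Finset.mem_filter, Finset.mem_powerset]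
      refine ⟨⟨Finset.inter_subset_right, hST⟩, Finset.inter_subset_right, fun i hi => ?_⟩
      rw [Finset.inter_assoc, Finset.inter_eq_right.2 (Finset.subset_biUnion_of_mem C hi)]
      exact hS i hi
    · rintro ⟨A, B⟩ h
      simp only [Finset.mem_product, Finset.mem_filter, Finset.mem_powerset] at h
      obtain ⟨⟨hA, -⟩, hB, -⟩ := h
      simp only [Prod.mk.injEq]
      constructor
      · rw [Finset.union_inter_distrib_right, Finset.inter_eq_left.2 hA,
          Finset.disjoint_iff_inter_eq_empty.1 (hd.symm.mono_left hB), Finset.union_empty]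
      · rw [Finset.union_inter_distrib_right, Finset.inter_eq_left.2 hB,
          Finset.disjoint_iff_inter_eq_empty.1 (hd.mono_left hA), Finset.empty_union]
    · intro S h
      simp only [Finset.mem_filter, Finset.mem_powerset, Finset.biUnion_insert] at h
      rw [← Finset.inter_union_distrib_left, Finset.inter_eq_left.2 h.1]
    · rintro ⟨A, B⟩ h
      simp only [Finset.mem_product, Finset.mem_filter, Finset.mem_powerset] at h
      rw [Finset.card_union_of_disjoint (hd.mono h.1.1 h.2.1), pow_add]

/-- The number of `n`-subsets of a partitioned type with constrained intersection sizes, as a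
coefficient of the generating function. -/
theorem card_filter_powersetCard_inter [Fintype α] [Fintype κ] (C : κ → Finset α)
    (T : κ → Finset ℕ) (hdisj : ∀ i j, i ≠ j → Disjoint (C i) (C j))
    (hcover : Finset.univ.biUnion C = Finset.univ) (n : ℕ)
    [DecidablePred fun S : Finset α => ∀ i, (S ∩ C i).card ∈ T i] :
    ((Finset.powersetCard n Finset.univ).filter fun S => ∀ i, (S ∩ C i).card ∈ T i).card
      = (∏ i, ∑ j ∈ T i, Polynomial.C ((C i).card.choose j) * (X : ℕ[X]) ^ j).coeff n := by
  rw [prod_sum_choose_X_pow _ C T hdisj, hcover, Polynomial.finsetSum_coeff]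
  simp only [Polynomial.coeff_X_pow, Finset.sum_boole, Nat.cast_id, Finset.filter_filter]
  congr 1
  ext S
  simp [Finset.mem_powersetCard, and_comm, eq_comm]

end

section

variable {α : Type*} [DecidableEq α] [Fintype α] {k : ℕ}

theorem card_filter_forall_inter_le
    (C : Fin (k + 1) → Finset α) (hdisj : ∀ i j, i ≠ j → Disjoint (C i) (C j))
    (hcover : Finset.univ.biUnion C = Finset.univ) (n : ℕ) {g : ℕ} (hg : 1 ≤ g) :
    ((Finset.powersetCard n Finset.univ).filter fun S => ∀ ℓ, (S ∩ C ℓ).card ≤ g - 1).card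
      = bCoeff k (fun ℓ => (C ℓ).card) n g := by
  unfold bCoeff catPoly
  rw [← card_filter_powersetCard_inter C (fun _ => Finset.range g) hdisj hcover]
  congr 1
  refine Finset.filter_congr fun S _ => forall_congr' fun ℓ => ?_
  rw [Finset.mem_range]
  omega

theorem card_filter_inter_eq
    (C : Fin (k + 1) → Finset α) (hdisj : ∀ i j, i ≠ j → Disjoint (C i) (C j))
    (hcover : Finset.univ.biUnion C = Finset.univ) (n : ℕ) {g : ℕ} (hg : 1 ≤ g)
    (hgn : g ≤ n) (ℓ : Fin (k + 1)) :
    ((Finset.powersetCard n Finset.univ).filter fun S =>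
        (S ∩ C ℓ).card = g ∧ ∀ ℓ', ℓ' ≠ ℓ → (S ∩ C ℓ').card ≤ g - 1).card
      = (C ℓ).card.choose g * aCoeff k (fun ℓ => (C ℓ).card) n g ℓ := by
  have key := card_filter_powersetCard_inter C
    (fun i => if i = ℓ then {g} else Finset.range g) hdisj hcover n
  rw [← Finset.mul_prod_erase _ _ (Finset.mem_univ ℓ), if_pos rfl, Finset.sum_singleton,
    Finset.prod_congr rfl (g := fun i => catPoly (C i).card g) (fun i hi => by
      rw [if_neg (Finset.ne_of_mem_erase hi)]; rfl),
    mul_assoc, Polynomial.coeff_C_mul, Polynomial.coeff_X_pow_mul', if_pos hgn] at key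
  unfold aCoeff
  rw [← key]
  congr 1
  refine Finset.filter_congr fun S _ => ?_
  constructor
  · rintro ⟨h, h'⟩ i
    by_cases hi : i = ℓ
    · subst hi
      simpa using h
    · have := h' i hi
      rw [if_neg hi, Finset.mem_range]
      omega
  · intro h
    refine ⟨by simpa using h ℓ, fun i hi => ?_⟩
    have := h i
    rw [if_neg hi, Finset.mem_range] at this
    omega

theorem card_filter_exists_inter_eq
    (C : Fin (k + 1) → Finset α) (hdisj : ∀ i j, i ≠ j → Disjoint (C i) (C j))
    (hcover : Finset.univ.biUnion C = Finset.univ) (n : ℕ) {g : ℕ} (hg : 1 ≤ g)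
    (hgn : g ≤ n) :
    ((Finset.powersetCard n Finset.univ).filter fun S =>
        ∃ ℓ, (S ∩ C ℓ).card = g ∧ ∀ ℓ', ℓ' ≠ ℓ → (S ∩ C ℓ').card ≤ g - 1).card
      = ∑ ℓ, (C ℓ).card.choose g * aCoeff k (fun ℓ => (C ℓ).card) n g ℓ := by
  simp_rw [← card_filter_inter_eq C hdisj hcover n hg hgn]
  rw [← Finset.card_biUnion]
  · congr 1
    ext S
    simp only [Finset.mem_filter, Finset.mem_biUnion, Finset.mem_univ, true_and,
      exists_and_left]
  · intro i _ j _ hij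
    rw [Function.onFun, Finset.disjoint_left]
    intro S hi hj
    have h₁ := (Finset.mem_filter.1 hi).2.1
    have h₂ := (Finset.mem_filter.1 hj).2.2 i hij
    omega

end

/-- In the multi-row setting, the probability `P(t, g)` that row `t`'s
sample has a mode (in some category) with mode number `g` while all category counts of
every other row's sample are strictly below `g` satisfies
`P(t, g) = ∑_ℓ P(t, ℓ, g) = q^t_g · ∏_{s∈τ\{t}} b^s_g / C(N s, n s)`, where
`q^t_g = ∑_ℓ C(m t ℓ, g)·a^t_{g,ℓ}/C(N t, n t)`.  (The first displayed equation is
the count of the corresponding tuples; the second is the probability identity.) -/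
theorem stmt_4 {ι : Type*} [DecidableEq ι] (τ : Finset ι) (t : ι) (ht : t ∈ τ)
    (k : ℕ) (N n : ι → ℕ)
    (C : (s : ι) → Fin (k + 1) → Finset (Fin (N s)))
    (hdisj : ∀ s, ∀ i j : Fin (k + 1), i ≠ j → Disjoint (C s i) (C s j))
    (hcover : ∀ s, Finset.univ.biUnion (C s) = (Finset.univ : Finset (Fin (N s))))
    (m : ι → Fin (k + 1) → ℕ) (hm : ∀ s ℓ, (C s ℓ).card = m s ℓ)
    (hn : ∀ s, n s ≤ N s)
    (g : ℕ) (hg : 1 ≤ g) (hgt : g ≤ n t) :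
    ((τ.pi (fun s => (Finset.powersetCard (n s) (Finset.univ : Finset (Fin (N s)))).filter
        (fun S => if s = t
          then (∃ ℓ : Fin (k + 1), (S ∩ C s ℓ).card = g ∧
            ∀ ℓ' : Fin (k + 1), ℓ' ≠ ℓ → (S ∩ C s ℓ').card ≤ g - 1)
          else (∀ ℓ'' : Fin (k + 1), (S ∩ C s ℓ'').card ≤ g - 1)))).card
      = ∑ ℓ : Fin (k + 1), (m t ℓ).choose g * aCoeff k (m t) (n t) g ℓ *
          ∏ s ∈ τ.erase t, bCoeff k (m s) (n s) g)
    ∧ (((τ.pi (fun s => (Finset.powersetCard (n s) (Finset.univ : Finset (Fin (N s)))).filter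
        (fun S => if s = t
          then (∃ ℓ : Fin (k + 1), (S ∩ C s ℓ).card = g ∧
            ∀ ℓ' : Fin (k + 1), ℓ' ≠ ℓ → (S ∩ C s ℓ').card ≤ g - 1)
          else (∀ ℓ'' : Fin (k + 1), (S ∩ C s ℓ'').card ≤ g - 1)))).card : ℚ)
        / ∏ s ∈ τ, ((N s).choose (n s) : ℚ)
      = (∑ ℓ : Fin (k + 1),
            ((m t ℓ).choose g * aCoeff k (m t) (n t) g ℓ : ℚ) / ((N t).choose (n t) : ℚ)) *
          ∏ s ∈ τ.erase t, (bCoeff k (m s) (n s) g : ℚ) / ((N s).choose (n s) : ℚ)) := by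
  obtain rfl : m = fun s ℓ => (C s ℓ).card := by
    funext s ℓ
    exact (hm s ℓ).symm
  have hcount := Finset.card_pi τ (fun s =>
      (Finset.powersetCard (n s) (Finset.univ : Finset (Fin (N s)))).filter
        (fun S => if s = t
          then (∃ ℓ : Fin (k + 1), (S ∩ C s ℓ).card = g ∧
            ∀ ℓ' : Fin (k + 1), ℓ' ≠ ℓ → (S ∩ C s ℓ').card ≤ g - 1)
          else (∀ ℓ'' : Fin (k + 1), (S ∩ C s ℓ'').card ≤ g - 1)))
  rw [← Finset.mul_prod_erase _ _ ht,
    Finset.prod_congr rfl (g := fun s => bCoeff k (fun ℓ => (C s ℓ).card) (n s) g)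
      (fun s hs => by
        simp only [if_neg (Finset.ne_of_mem_erase hs)]
        exact card_filter_forall_inter_le (C s) (hdisj s) (hcover s) (n s) hg)] at hcount
  simp only [if_true] at hcount
  rw [card_filter_exists_inter_eq (C t) (hdisj t) (hcover t) (n t) hg hgt] at hcount
  rw [hcount]
  refine ⟨Finset.sum_mul _ _ _, ?_⟩
  rw [← Finset.mul_prod_erase τ _ ht, ← Finset.sum_div, Finset.prod_div_distrib,
    div_mul_div_comm]
  push_cast
  rfl
end

section
/- Let A ∈ ℝ^{d1×d2} with A ≠ 0 and nonzero rows, let x* satisfy A x* = b, let e_0 = 0 ∈ ℝ^{d1} and e_1, …, e_k ∈ ℝ^{d1}, and let q_0, …, q_k ≥ 0 with Σ_{ℓ=0}^{k} q_ℓ = 1. Then for every x ∈ ℝ^{d2}: Σ_{ℓ=0}^{k} q_ℓ · Σ_{j=1}^{d1} (‖A_j‖₂² / ‖A‖_F²) · ‖x − ((⟨A_j, x⟩ − (b_j + e_ℓ(j))) / ‖A_j‖₂²) A_jᵀ − x*‖₂² ≤ (1 − σ_min(A)² / ‖A‖_F²) · ‖x − x*‖₂² + (1/‖A‖_F²) ·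 Σ_{ℓ=1}^{k} q_ℓ · ‖e_ℓ‖₂². -/
/-- The smallest singular value of `M`: the largest `σ ≥ 0` with `‖My‖₂ ≥ σ‖y‖₂` for all `y`. -/
noncomputable def sigmaMin {d1 d2 : ℕ} (M : Matrix (Fin d1) (Fin d2) ℝ) : ℝ :=
  sSup {σ : ℝ | 0 ≤ σ ∧ ∀ y : Fin d2 → ℝ,
    σ * Real.sqrt (∑ i, y i ^ 2) ≤ Real.sqrt (∑ i, (∑ j, M i j * y j) ^ 2)}

/-- The smallest singular value is nonnegative. -/
theorem sigmaMin_nonneg {d1 d2 : ℕ} (M : Matrix (Fin d1) (Fin d2) ℝ) : 0 ≤ sigmaMin M :=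
  Real.sSup_nonneg fun _ hσ => hσ.1

/-- The lower bound `σ_min(M)² ‖y‖₂² ≤ ‖My‖₂²`. -/
theorem sigmaMin_sq_mul_le {d1 d2 : ℕ} (M : Matrix (Fin d1) (Fin d2) ℝ) (y : Fin d2 → ℝ) :
    sigmaMin M ^ 2 * ∑ i, y i ^ 2 ≤ ∑ j, (∑ i, M j i * y i) ^ 2 := by
  have hy : 0 ≤ ∑ i, y i ^ 2 := by positivity
  have hMy : 0 ≤ ∑ j, (∑ i, M j i * y i) ^ 2 := by positivity
  rcases hy.eq_or_lt with h | h
  · rwa [← h, mul_zero]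
  have hle : sigmaMin M ≤
      Real.sqrt (∑ j, (∑ i, M j i * y i) ^ 2) / Real.sqrt (∑ i, y i ^ 2) :=
    Real.sSup_le (fun σ hσ => (le_div_iff₀ (Real.sqrt_pos.2 h)).2 (hσ.2 y)) (by positivity)
  have hsq := pow_le_pow_left₀ (sigmaMin_nonneg M) hle 2
  rwa [div_pow, Real.sq_sqrt hMy, Real.sq_sqrt hy, le_div_iff₀ h] at hsq

/-- The squared error after a relaxed projection along `a`, where the residual `⟨a, z⟩` is
perturbed by `ε`, weighted by `‖a‖₂²`. -/
theorem sum_sq_mul_sum_sub_sq {ι : Type*} [Fintype ι] (a z : ι → ℝ) (ε : ℝ)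
    (ha : ∑ i, a i ^ 2 ≠ 0) :
    (∑ i, a i ^ 2) * ∑ i, (z i - ((∑ i', a i' * z i') - ε) / (∑ i', a i' ^ 2) * a i) ^ 2
      = (∑ i, a i ^ 2) * ∑ i, z i ^ 2 - (∑ i, a i * z i) ^ 2 + ε ^ 2 := by
  have expand (t : ℝ) : ∑ i, (z i - t * a i) ^ 2
      = ∑ i, z i ^ 2 - 2 * t * ∑ i, a i * z i + t ^ 2 * ∑ i, a i ^ 2 := by
    simp only [Finset.mul_sum, ← Finset.sum_sub_distrib, ← Finset.sum_add_distrib]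
    exact Finset.sum_congr rfl fun i _ => by ring
  rw [expand]
  field_simp
  ring

/-- One-step expected contraction for the single-row distributed
randomized Kaczmarz method: sampling row `j` with probability `‖A_j‖₂²/‖A‖_F²` and,
independently, error category `ℓ` with probability `q ℓ` (`ℓ = 0` error-free),
`∑_ℓ q_ℓ ∑_j (‖A_j‖₂²/‖A‖_F²)·‖x − ((⟨A_j,x⟩ − (b_j + e_ℓ(j)))/‖A_j‖₂²)A_jᵀ − x*‖₂²
  ≤ (1 − σ_min(A)²/‖A‖_F²)·‖x − x*‖₂² + (1/‖A‖_F²)·∑_{ℓ=1}^{k} q_ℓ‖e_ℓ‖₂²`. -/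
theorem stmt_13 (d1 d2 k : ℕ)
    (A : Matrix (Fin d1) (Fin d2) ℝ) (hA : A ≠ 0)
    (hrows : ∀ j, ∑ i, A j i ^ 2 ≠ 0)
    (b : Fin d1 → ℝ) (xstar : Fin d2 → ℝ)
    (hsol : ∀ j, ∑ i, A j i * xstar i = b j)
    (e : Fin (k + 1) → Fin d1 → ℝ) (he0 : e 0 = 0)
    (q : Fin (k + 1) → ℝ) (hq : ∀ ℓ, 0 ≤ q ℓ) (hq1 : ∑ ℓ, q ℓ = 1)
    (x : Fin d2 → ℝ) :
    ∑ ℓ : Fin (k + 1), q ℓ *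
        ∑ j, ((∑ i, A j i ^ 2) / (∑ j', ∑ i, A j' i ^ 2)) *
          ∑ i, ((x i - ((∑ i', A j i' * x i') - (b j + e ℓ j)) / (∑ i', A j i' ^ 2)
              * A j i) - xstar i) ^ 2
      ≤ (1 - sigmaMin A ^ 2 / (∑ j', ∑ i, A j' i ^ 2)) * ∑ i, (x i - xstar i) ^ 2
        + (1 / (∑ j', ∑ i, A j' i ^ 2)) *
            ∑ ℓ ∈ Finset.univ.erase (0 : Fin (k + 1)), q ℓ * ∑ j, e ℓ j ^ 2 := by
  set F := ∑ j', ∑ i, A j' i ^ 2 with hF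
  have hFpos : 0 < F := by
    obtain ⟨j, -⟩ : ∃ j, A j ≠ 0 := Function.ne_iff.1 hA
    exact Finset.sum_pos (fun j _ => lt_of_le_of_ne (by positivity) (hrows j).symm) ⟨j, by simp⟩
  have residual (j : Fin d1) (ε : ℝ) :
      (∑ i, A j i * x i) - (b j + ε) = (∑ i, A j i * (x i - xstar i)) - ε := by
    simp only [mul_sub, Finset.sum_sub_distrib, hsol]
    ring
  have row (ℓ : Fin (k + 1)) (j : Fin d1) :
      (∑ i, A j i ^ 2) / F *
          ∑ i, ((x i - ((∑ i', A j i' * x i') - (b j + e ℓ j)) / (∑ i', A j i' ^ 2)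
              * A j i) - xstar i) ^ 2
        = ((∑ i, A j i ^ 2) * ∑ i, (x i - xstar i) ^ 2
            - (∑ i, A j i * (x i - xstar i)) ^ 2 + e ℓ j ^ 2) / F := by
    rw [div_mul_eq_mul_div, residual,
      ← sum_sq_mul_sum_sub_sq (A j) (fun i => x i - xstar i) (e ℓ j) (hrows j)]
    simp only [sub_right_comm]
  have herase : ∑ ℓ ∈ Finset.univ.erase (0 : Fin (k + 1)), q ℓ * ∑ j, e ℓ j ^ 2
      = ∑ ℓ, q ℓ * ∑ j, e ℓ j ^ 2 :=
    Finset.sum_erase _ (by simp [he0])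
  simp only [row, ← Finset.sum_div, Finset.sum_add_distrib, Finset.sum_sub_distrib,
    ← Finset.sum_mul, ← hF, herase, add_div, mul_add, ← mul_div_assoc, hq1, one_mul]
  have hσ := div_le_div_of_nonneg_right
    (sigmaMin_sq_mul_le A fun i => x i - xstar i) hFpos.le
  have hsplit : (F * ∑ i, (x i - xstar i) ^ 2) / F = ∑ i, (x i - xstar i) ^ 2 :=
    mul_div_cancel_left₀ _ hFpos.ne'
  rw [sub_div, hsplit, sub_mul, one_mul, div_mul_eq_mul_div, div_mul_eq_mul_div, one_mul]
  linarith
end
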